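/- arXiv:1712.07897 — 9 statements merged into one kernel-verified Lean document; each statement's English description precedes it below -/
import Mathlib

section
/- Let C ⊆ ℝ^p be a nonempty (possibly non-convex) set and f : ℝ^p → ℝ a differentiable function satisfying α-RSC and β-RSS over C with β/α < 2. Let x* ∈ C satisfy f(x*) = min_{x∈C} f(x) and ∇f(x*) = 0. Suppose x^t ∈ C, z^{t+1} = x^t − (1/β)·∇f(x^t), and x^{t+1} ∈ C satisfies ‖x^{t+1} − z^{t+1}‖₂ ≤ ‖x − z^{t+1}‖₂ for all x ∈ C. Then f(x^{t+1}) − f(x*) ≤ (β/α − 1)·(f(x^t) − f(x*)). Consequently, generalized projected gradient descent iterates of this form satisfy f(x^T) − f(x*) ≤ (β/α − 1)^{T−1}·(f(x¹) − f(x*)) for all T ≥ 1. -/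
open scoped RealInnerProductSpace

/-- If `x - (1/β) • v` is at least as close to `y` as to `w`, then the quadratic model
`u ↦ ⟪v, u - x⟫ + (β/2) ‖u - x‖²` is at most as large at `y` as at `w`. -/
lemma quadratic_model_le_of_norm_sub_le {E : Type*} [NormedAddCommGroup E]
    [InnerProductSpace ℝ E] {β : ℝ} (hβ : 0 < β) {x y w v : E}
    (h : ‖y - (x - (1/β) • v)‖ ≤ ‖w - (x - (1/β) • v)‖) :
    ⟪v, y - x⟫ + (β/2) * ‖y - x‖^2 ≤ ⟪v, w - x⟫ + (β/2) * ‖w - x‖^2 := by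
  have expand (u : E) : (β/2) * ‖u - (x - (1/β) • v)‖^2 =
      ⟪v, u - x⟫ + (β/2) * ‖u - x‖^2 + (β/2) * ‖(1/β) • v‖^2 := by
    rw [show u - (x - (1/β) • v) = (u - x) + (1/β) • v by abel, norm_add_sq_real,
      inner_smul_right, real_inner_comm]
    field_simp
    ring
  have hsq : (β/2) * ‖y - (x - (1/β) • v)‖^2 ≤ (β/2) * ‖w - (x - (1/β) • v)‖^2 := by gcongr
  rw [expand, expand] at hsq
  linarith

/-- Strong convexity with a constant exceeding the smoothness constant forces the two
points to coincide. -/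
lemma eq_of_strong_convexity_gt_smoothness {E : Type*} [NormedAddCommGroup E]
    {α β b : ℝ} (h : β < α) {x y : E}
    (hl : (α/2) * ‖y - x‖^2 ≤ b) (hu : b ≤ (β/2) * ‖y - x‖^2) : y = x := by
  have hsq : ‖y - x‖^2 = 0 := by nlinarith [sq_nonneg ‖y - x‖]
  exact sub_eq_zero.mp (norm_eq_zero.mp (pow_eq_zero_iff two_ne_zero |>.mp hsq))

/-- Generalized projected gradient descent for a function satisfying `α`-RSC and `β`-RSS
over a (possibly non-convex) set `C` with `β/α < 2`, where the optimum `x* ∈ C` has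
vanishing gradient: each (non-convex) projected gradient step with step length `1/β`
contracts the suboptimality by `(β/α - 1)`, and consequently
`f(x^T) - f(x*) ≤ (β/α - 1)^{T-1} (f(x¹) - f(x*))` for all `T ≥ 1`. -/
theorem gpgd_rsc_rss
    {p : ℕ} (C : Set (EuclideanSpace ℝ (Fin p))) (hCne : C.Nonempty)
    (f : EuclideanSpace ℝ (Fin p) → ℝ)
    (g : EuclideanSpace ℝ (Fin p) → EuclideanSpace ℝ (Fin p))
    (hgrad : ∀ x, HasGradientAt f (g x) x)
    (α β : ℝ) (hα : 0 < α) (hκ : β / α < 2)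
    (hrscss : ∀ x ∈ C, ∀ y ∈ C,
      (α/2) * ‖y - x‖^2 ≤ f y - f x - ⟪g x, y - x⟫ ∧
      f y - f x - ⟪g x, y - x⟫ ≤ (β/2) * ‖y - x‖^2)
    (xstar : EuclideanSpace ℝ (Fin p)) (hxstarC : xstar ∈ C)
    (hxstarmin : ∀ x ∈ C, f xstar ≤ f x)
    (hgstar : g xstar = 0) :
    (∀ xt xt1 : EuclideanSpace ℝ (Fin p), xt ∈ C → xt1 ∈ C →
      (∀ w ∈ C, ‖xt1 - (xt - (1/β) • g xt)‖ ≤ ‖w - (xt - (1/β) • g xt)‖) →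
      f xt1 - f xstar ≤ (β/α - 1) * (f xt - f xstar)) ∧
    (∀ x : ℕ → EuclideanSpace ℝ (Fin p),
      (∀ t, 1 ≤ t → x t ∈ C) →
      (∀ t, 1 ≤ t →
        ∀ w ∈ C, ‖x (t+1) - (x t - (1/β) • g (x t))‖ ≤ ‖w - (x t - (1/β) • g (x t))‖) →
      ∀ T, 1 ≤ T → f (x T) - f xstar ≤ (β/α - 1)^(T-1) * (f (x 1) - f xstar)) := by
  rcases lt_or_ge β α with hβα | hαβ
  · have heq (x : EuclideanSpace ℝ (Fin p)) (hx : x ∈ C) : x = xstar :=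
      eq_of_strong_convexity_gt_smoothness hβα (hrscss xstar hxstarC x hx).1
        (hrscss xstar hxstarC x hx).2
    refine ⟨fun xt xt1 hxt hxt1 _ => ?_, fun x hx _ T hT => ?_⟩
    · simp [heq xt hxt, heq xt1 hxt1]
    · simp [heq _ (hx T hT), heq _ (hx 1 le_rfl)]
  · have hβ : 0 < β := hα.trans_le hαβ
    have hrate : 0 ≤ β/α - 1 := sub_nonneg.mpr ((one_le_div hα).mpr hαβ)
    have step (xt xt1 : EuclideanSpace ℝ (Fin p)) (hxt : xt ∈ C) (hxt1 : xt1 ∈ C)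
        (hproj : ∀ w ∈ C, ‖xt1 - (xt - (1/β) • g xt)‖ ≤ ‖w - (xt - (1/β) • g xt)‖) :
        f xt1 - f xstar ≤ (β/α - 1) * (f xt - f xstar) := by
      have hmodel := quadratic_model_le_of_norm_sub_le hβ (hproj xstar hxstarC)
      have hsmooth := (hrscss xt hxt xt1 hxt1).2
      have hconv := (hrscss xt hxt xstar hxstarC).1
      have hgrowth := (hrscss xstar hxstarC xt hxt).1
      rw [hgstar, inner_zero_left, sub_zero, norm_sub_rev] at hgrowth
      calc f xt1 - f xstar ≤ (β/α - 1) * ((α/2) * ‖xstar - xt‖^2) := by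
            have hscale : (β/α - 1) * ((α/2) * ‖xstar - xt‖^2) =
                (β/2) * ‖xstar - xt‖^2 - (α/2) * ‖xstar - xt‖^2 := by
              field_simp
            linarith
        _ ≤ (β/α - 1) * (f xt - f xstar) := by gcongr
    refine ⟨step, fun x hx hproj T hT => ?_⟩
    induction T, hT using Nat.le_induction with
    | base => simp
    | succ n hn ih =>
      calc f (x (n+1)) - f xstar ≤ (β/α - 1) * (f (x n) - f xstar) :=
            step _ _ (hx n hn) (hx (n+1) (by lia)) (hproj n hn)
        _ ≤ (β/α - 1) * ((β/α - 1)^(n-1) * (f (x 1) - f xstar)) := by gcongr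
        _ = (β/α - 1)^(n+1-1) * (f (x 1) - f xstar) := by
            rw [← mul_assoc, ← pow_succ', Nat.sub_add_cancel hn, Nat.add_sub_cancel]
end

section
/- Let f : ℝ^p × ℝ^q → ℝ be differentiable, jointly convex, and β-marginally strongly smooth in its first variable. Assume f attains its minimum value f* at some point (x*, y*), and that the sublevel set S₀ = {(x, y) : f(x, y) ≤ f(0, 0)} is contained in the Euclidean ball of radius R around the origin of ℝ^{p+q}. Define alternating minimization iterates by (x¹, y¹) = (0, 0) and, for t ≥ 1, x^{t+1} ∈ argmin_{x∈ℝ^p} f(x, y^t) and y^{t+1} ∈ argmin_{y∈ℝ^q} f(x^{t+1}, y), assuming these minimizers exist. Then for every T ≥ 3: f(x^T, y^T) − f* ≤ 4βR²/(T − 2). -/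
open scoped RealInnerProductSpace

theorem HasGradientAt.eq_zero_of_forall_le {E : Type*} [NormedAddCommGroup E]
    [InnerProductSpace ℝ E] [CompleteSpace E] {h : E → ℝ} {g a : E}
    (hg : HasGradientAt h g a) (hmin : ∀ b, h a ≤ h b) : g = 0 := by
  have h0 := IsLocalMin.hasFDerivAt_eq_zero (Filter.Eventually.of_forall hmin) hg.hasFDerivAt
  simpa using h0

/-- One step of a recursion `a * b ≤ C * (a - b)` preserves the rate `a * n ≤ C`. -/
theorem mul_add_one_le_of_mul_le_mul_sub {C a b n : ℝ} (hC : 0 < C) (ha : 0 ≤ a) (hb : 0 ≤ b)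
    (hstep : a * b ≤ C * (a - b)) (hn : a * n ≤ C) : b * (n + 1) ≤ C := by
  rcases ha.eq_or_lt with rfl | ha
  · have : b = 0 := by nlinarith
    simp [this, hC.le]
  · have h := mul_le_mul_of_nonneg_left hn hb
    refine le_of_mul_le_mul_right ?_ ha
    linarith

/-- Alternating minimization for a differentiable, jointly convex function that is
`β`-marginally strongly smooth in its first variable, whose sublevel set at the origin is
contained in a ball of radius `R`, and which attains its minimum `f*`: starting from
`(x¹, y¹) = (0, 0)`, the iterates satisfy `f(x^T, y^T) - f* ≤ 4βR²/(T - 2)` for `T ≥ 3`. -/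
theorem gam_jointly_convex_convergence
    {p q : ℕ}
    (f : EuclideanSpace ℝ (Fin p) → EuclideanSpace ℝ (Fin q) → ℝ)
    (gx : EuclideanSpace ℝ (Fin p) → EuclideanSpace ℝ (Fin q) → EuclideanSpace ℝ (Fin p))
    (gy : EuclideanSpace ℝ (Fin p) → EuclideanSpace ℝ (Fin q) → EuclideanSpace ℝ (Fin q))
    (hdiff : Differentiable ℝ
      (fun z : EuclideanSpace ℝ (Fin p) × EuclideanSpace ℝ (Fin q) => f z.1 z.2))
    (hgx : ∀ x y, HasGradientAt (fun x' => f x' y) (gx x y) x)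
    (hgy : ∀ x y, HasGradientAt (fun y' => f x y') (gy x y) y)
    (hconv : ∀ x1 y1 x2 y2,
      f x1 y1 + ⟪gx x1 y1, x2 - x1⟫ + ⟪gy x1 y1, y2 - y1⟫ ≤ f x2 y2)
    (β : ℝ) (hβ : 0 < β)
    (hmss : ∀ y x1 x2, f x2 y - f x1 y - ⟪gx x1 y, x2 - x1⟫ ≤ (β/2) * ‖x2 - x1‖^2)
    (fstar : ℝ) (xs : EuclideanSpace ℝ (Fin p)) (ys : EuclideanSpace ℝ (Fin q))
    (hfs : f xs ys = fstar) (hmin : ∀ x y, fstar ≤ f x y)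
    (R : ℝ) (hR0 : 0 ≤ R)
    (hS0 : ∀ x y, f x y ≤ f 0 0 → ‖x‖^2 + ‖y‖^2 ≤ R^2)
    (x : ℕ → EuclideanSpace ℝ (Fin p)) (y : ℕ → EuclideanSpace ℝ (Fin q))
    (hx1 : x 1 = 0) (hy1 : y 1 = 0)
    (hxmin : ∀ t, 1 ≤ t → ∀ x', f (x (t+1)) (y t) ≤ f x' (y t))
    (hymin : ∀ t, 1 ≤ t → ∀ y', f (x (t+1)) (y (t+1)) ≤ f (x (t+1)) y') :
    ∀ T : ℕ, 3 ≤ T → f (x T) (y T) - fstar ≤ 4 * β * R^2 / ((T : ℝ) - 2) := by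
  have hgx0 : ∀ t, 1 ≤ t → gx (x (t + 1)) (y t) = 0 := fun t ht =>
    (hgx _ _).eq_zero_of_forall_le (hxmin t ht)
  have hgy0 : ∀ t, 1 ≤ t → gy (x (t + 1)) (y (t + 1)) = 0 := fun t ht =>
    (hgy _ _).eq_zero_of_forall_le (hymin t ht)
  have hmono : ∀ t, 1 ≤ t → f (x t) (y t) ≤ f 0 0 := by
    intro t ht
    induction t, ht using Nat.le_induction with
    | base => rw [hx1, hy1]
    | succ t ht ih => exact ((hymin t ht _).trans (hxmin t ht _)).trans ih
  have hnorm : ∀ u v, f u v ≤ f 0 0 → ‖u‖ ≤ R := fun u v h =>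
    abs_le_of_sq_le_sq' (by nlinarith [hS0 u v h, sq_nonneg ‖v‖]) hR0 |>.2
  have hgap : ∀ t, 1 ≤ t → f (x (t + 1)) (y (t + 1)) - fstar
      ≤ 2 * R * ‖gx (x (t + 1)) (y (t + 1))‖ := by
    intro t ht
    have h1 := hconv (x (t + 1)) (y (t + 1)) xs ys
    rw [hgy0 t ht, inner_zero_left, hfs] at h1
    have h2 := abs_le.1 (abs_real_inner_le_norm (gx (x (t + 1)) (y (t + 1))) (xs - x (t + 1)))
    have h3 : ‖xs - x (t + 1)‖ ≤ 2 * R := by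
      have := norm_sub_le xs (x (t + 1))
      have := hnorm xs ys (hfs.trans_le (hmin 0 0))
      have := hnorm _ _ (hmono (t + 1) (by omega))
      linarith
    have h4 := mul_le_mul_of_nonneg_left h3 (norm_nonneg (gx (x (t + 1)) (y (t + 1))))
    linarith [h2.1]
  -- The `x`-update gains `‖gx (x t) (y t)‖² / (2β)`.
  have hdescx : ∀ t, 1 ≤ t → f (x (t + 1)) (y t)
      ≤ f (x t) (y t) - ‖gx (x t) (y t)‖ ^ 2 / (2 * β) := by
    intro t ht
    have h1 := hxmin t ht (x t - β⁻¹ • gx (x t) (y t))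
    have h2 := hmss (y t) (x t) (x t - β⁻¹ • gx (x t) (y t))
    rw [sub_sub_cancel_left, inner_neg_right, real_inner_smul_right, real_inner_self_eq_norm_sq,
      norm_neg, norm_smul, mul_pow, Real.norm_eq_abs, sq_abs] at h2
    have h3 : β / 2 * (β⁻¹ ^ 2 * ‖gx (x t) (y t)‖ ^ 2) - β⁻¹ * ‖gx (x t) (y t)‖ ^ 2
        = - (‖gx (x t) (y t)‖ ^ 2 / (2 * β)) := by
      field_simp
      ring
    linarith
  -- The `y`-update creates a new partial gradient in `x`, hence gains its square over `2β`.
  have hdescy : ∀ t, 1 ≤ t → f (x (t + 1)) (y (t + 1))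
      ≤ f (x (t + 1)) (y t) - ‖gx (x (t + 1)) (y (t + 1))‖ ^ 2 / (2 * β) := by
    intro t ht
    set g := gx (x (t + 1)) (y (t + 1)) with hg
    have h1 := hconv (x (t + 1)) (y (t + 1)) (x (t + 1) + β⁻¹ • g) (y t)
    have h2 := hmss (y t) (x (t + 1)) (x (t + 1) + β⁻¹ • g)
    rw [hgy0 t ht, inner_zero_left, ← hg, add_sub_cancel_left, real_inner_smul_right,
      real_inner_self_eq_norm_sq] at h1
    rw [hgx0 t ht, inner_zero_left, add_sub_cancel_left, norm_smul, mul_pow, Real.norm_eq_abs,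
      sq_abs] at h2
    have h3 : β / 2 * (β⁻¹ ^ 2 * ‖g‖ ^ 2) - β⁻¹ * ‖g‖ ^ 2 = - (‖g‖ ^ 2 / (2 * β)) := by
      field_simp
      ring
    linarith
  have hstep : ∀ t, 1 ≤ t →
      (f (x (t + 1)) (y (t + 1)) - fstar) * (f (x (t + 2)) (y (t + 2)) - fstar)
        ≤ 4 * β * R ^ 2 *
          ((f (x (t + 1)) (y (t + 1)) - fstar) - (f (x (t + 2)) (y (t + 2)) - fstar)) := by
    intro t ht
    have hab := mul_le_mul (hgap t ht) (hgap (t + 1) (by omega))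
      (sub_nonneg.2 (hmin _ _)) (by positivity)
    have h1 := hdescx (t + 1) (by omega)
    have h2 := hdescy (t + 1) (by omega)
    simp only [add_assoc, Nat.reduceAdd] at hab h1 h2
    set g := ‖gx (x (t + 1)) (y (t + 1))‖
    set g' := ‖gx (x (t + 2)) (y (t + 2))‖
    have h3 : (g ^ 2 + g' ^ 2) / (2 * β)
        ≤ f (x (t + 1)) (y (t + 1)) - f (x (t + 2)) (y (t + 2)) := by
      rw [add_div]
      linarith
    rw [div_le_iff₀ (by positivity)] at h3
    have h4 := mul_le_mul_of_nonneg_left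
      ((two_mul_le_add_sq g g').trans h3) (by positivity : 0 ≤ 2 * R ^ 2)
    linarith
  rcases hR0.eq_or_lt with rfl | hR
  · intro T hT
    obtain ⟨t, rfl⟩ : ∃ t, T = t + 1 := ⟨T - 1, by omega⟩
    simpa using hgap t (by omega)
  have hrate : ∀ n : ℕ, (f (x (n + 2)) (y (n + 2)) - fstar) * n ≤ 4 * β * R ^ 2 := by
    intro n
    induction n with
    | zero => simp; positivity
    | succ n ih =>
      push_cast
      exact mul_add_one_le_of_mul_le_mul_sub (by positivity) (sub_nonneg.2 (hmin _ _))
        (sub_nonneg.2 (hmin _ _)) (hstep (n + 1) (by omega)) ih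
  intro T hT
  obtain ⟨n, rfl⟩ : ∃ n, T = n + 2 := ⟨T - 2, by omega⟩
  have hn : (0 : ℝ) < n := by exact_mod_cast (by omega : 0 < n)
  rw [Nat.cast_add, Nat.cast_ofNat, add_sub_cancel_right, le_div_iff₀ hn]
  exact hrate n
end

section
/- In the EM analysis setting, assume the (r, α)-LSC and (r, β)-LSS properties hold with α, β, r > 0, and assume M maps the closed ball B(θ*, r) into B(θ*, r). Then the M operator is (β/α)-Lipschitz at θ*: for every θ ∈ B(θ*, r), ‖M(θ) − M(θ*)‖₂ = ‖M(θ) − θ*‖₂ ≤ (β/α)·‖θ − θ*‖₂. -/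
open scoped RealInnerProductSpace

/-- In the EM analysis setting, under `(r, α)`-local strong concavity and `(r, β)`-local
strong smoothness (with `α, β, r > 0`), if the M-step operator maps the ball
`B(θ*, r)` into itself then it is `(β/α)`-Lipschitz at the self-consistent optimum `θ*`. -/
theorem em_M_operator_contraction
    {p : ℕ}
    (q : EuclideanSpace ℝ (Fin p) → EuclideanSpace ℝ (Fin p) → ℝ)
    (gq : EuclideanSpace ℝ (Fin p) → EuclideanSpace ℝ (Fin p) → EuclideanSpace ℝ (Fin p))
    (hgrad : ∀ θ x, HasGradientAt (q θ) (gq θ x) x)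
    (M : EuclideanSpace ℝ (Fin p) → EuclideanSpace ℝ (Fin p))
    (hM : ∀ θ, gq θ (M θ) = 0)
    (θs : EuclideanSpace ℝ (Fin p)) (hself : M θs = θs)
    (r α β : ℝ) (hr : 0 < r) (hα : 0 < α) (hβ : 0 < β)
    (hLSC : ∀ θ1 ∈ Metric.closedBall θs r, ∀ θ2 ∈ Metric.closedBall θs r,
      q θs θ1 - q θs θ2 - ⟪gq θs θ2, θ1 - θ2⟫ ≤ -(α/2) * ‖θ1 - θ2‖^2)
    (hLSS : ∀ θ1 ∈ Metric.closedBall θs r, ∀ θ2 ∈ Metric.closedBall θs r,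
      ‖gq θs (M θ1) - gq θs (M θ2)‖ ≤ β * ‖θ1 - θ2‖)
    (hmap : ∀ θ ∈ Metric.closedBall θs r, M θ ∈ Metric.closedBall θs r) :
    ∀ θ ∈ Metric.closedBall θs r,
      ‖M θ - M θs‖ = ‖M θ - θs‖ ∧ ‖M θ - θs‖ ≤ (β/α) * ‖θ - θs‖ := by
  intro θ hθ
  have hs : θs ∈ Metric.closedBall θs r := Metric.mem_closedBall_self hr.le
  have hgs : gq θs θs = 0 := by simpa only [hself] using hM θs
  refine ⟨by rw [hself], ?_⟩
  have h1 := hLSC (M θ) (hmap θ hθ) θs hs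
  have h2 := hLSC θs hs (M θ) (hmap θ hθ)
  have h3 := hLSS θ hθ θs hs
  rw [hself, hgs, sub_zero] at h3
  rw [hgs, inner_zero_left] at h1
  rw [norm_sub_rev θs (M θ)] at h2
  have h4 := real_inner_le_norm (gq θs (M θ)) (θs - M θ)
  rw [norm_sub_rev θs (M θ)] at h4
  have h5 := mul_le_mul_of_nonneg_right h3 (norm_nonneg (M θ - θs))
  rw [div_mul_eq_mul_div, le_div_iff₀ hα]
  rcases (norm_nonneg (M θ - θs)).eq_or_lt with h0 | hpos
  · rw [← h0, zero_mul]
    positivity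
  · refine le_of_mul_le_mul_right ?_ hpos
    linarith
end

section
/- In the EM analysis setting, assume the (r, α)-LSC and (r, β)-LSS properties hold with 0 < β < α and r > 0, and assume M maps the closed ball B(θ*, r) into B(θ*, r). If θ¹ ∈ B(θ*, r) and the EM iterates are θ^{t+1} = M(θ^t) for t ≥ 1, then every iterate remains in B(θ*, r) and ‖θ^t − θ*‖₂ ≤ (β/α)^{t−1}·‖θ¹ − θ*‖₂ for every t ≥ 1; in particular, for any ε > 0, ‖θ^T − θ*‖₂ ≤ ε once (β/α)^{T−1}·r ≤ ε, i.e., after T = O(log(r/ε)) iterations. -/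
open scoped RealInnerProductSpace

/-- The gradient of a strongly concave function is strongly monotone: adding the strong concavity
inequalities for `(x, y)` and `(y, x)`. -/
theorem inner_sub_le_neg_mul_norm_sq_of_strong_concave
    {E : Type*} [NormedAddCommGroup E] [InnerProductSpace ℝ E]
    {f : E → ℝ} {g : E → E} {α : ℝ} {x y : E}
    (hxy : f x - f y - ⟪g y, x - y⟫ ≤ -(α / 2) * ‖x - y‖ ^ 2)
    (hyx : f y - f x - ⟪g x, y - x⟫ ≤ -(α / 2) * ‖y - x‖ ^ 2) :
    ⟪g x - g y, x - y⟫ ≤ -α * ‖x - y‖ ^ 2 := by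
  rw [norm_sub_rev y x, ← neg_sub x y, inner_neg_right] at hyx
  rw [inner_sub_left]
  linarith

/-- Cauchy–Schwarz form of strong monotonicity of the gradient. -/
theorem mul_norm_sub_le_norm_sub_of_strong_concave
    {E : Type*} [NormedAddCommGroup E] [InnerProductSpace ℝ E]
    {f : E → ℝ} {g : E → E} {α : ℝ} {x y : E}
    (hxy : f x - f y - ⟪g y, x - y⟫ ≤ -(α / 2) * ‖x - y‖ ^ 2)
    (hyx : f y - f x - ⟪g x, y - x⟫ ≤ -(α / 2) * ‖y - x‖ ^ 2) :
    α * ‖x - y‖ ≤ ‖g x - g y‖ := by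
  rcases (norm_nonneg (x - y)).eq_or_lt with h | h
  · rw [← h, mul_zero]
    exact norm_nonneg _
  · have hmono := inner_sub_le_neg_mul_norm_sq_of_strong_concave hxy hyx
    have hcs := (abs_le.mp (abs_real_inner_le_norm (g x - g y) (x - y))).1
    refine le_of_mul_le_mul_right ?_ h
    linarith

/-- Local linear convergence of the EM algorithm: under `(r, α)`-LSC and `(r, β)`-LSS with
`0 < β < α`, if the M-step operator maps `B(θ*, r)` into itself and `θ¹ ∈ B(θ*, r)`, then
the EM iterates `θ^{t+1} = M(θᵗ)` stay in the ball, satisfy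
`‖θᵗ - θ*‖ ≤ (β/α)^{t-1}‖θ¹ - θ*‖`, and in particular are `ε`-close to `θ*` once
`(β/α)^{T-1}·r ≤ ε`. -/
theorem em_local_convergence
    {p : ℕ}
    (q : EuclideanSpace ℝ (Fin p) → EuclideanSpace ℝ (Fin p) → ℝ)
    (gq : EuclideanSpace ℝ (Fin p) → EuclideanSpace ℝ (Fin p) → EuclideanSpace ℝ (Fin p))
    (hgrad : ∀ θ x, HasGradientAt (q θ) (gq θ x) x)
    (M : EuclideanSpace ℝ (Fin p) → EuclideanSpace ℝ (Fin p))
    (hM : ∀ θ, gq θ (M θ) = 0)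
    (θs : EuclideanSpace ℝ (Fin p)) (hself : M θs = θs)
    (r α β : ℝ) (hr : 0 < r) (hβ : 0 < β) (hβα : β < α)
    (hLSC : ∀ θ1 ∈ Metric.closedBall θs r, ∀ θ2 ∈ Metric.closedBall θs r,
      q θs θ1 - q θs θ2 - ⟪gq θs θ2, θ1 - θ2⟫ ≤ -(α/2) * ‖θ1 - θ2‖^2)
    (hLSS : ∀ θ1 ∈ Metric.closedBall θs r, ∀ θ2 ∈ Metric.closedBall θs r,
      ‖gq θs (M θ1) - gq θs (M θ2)‖ ≤ β * ‖θ1 - θ2‖)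
    (hmap : ∀ θ ∈ Metric.closedBall θs r, M θ ∈ Metric.closedBall θs r)
    (θ : ℕ → EuclideanSpace ℝ (Fin p))
    (hθ1 : θ 1 ∈ Metric.closedBall θs r)
    (hit : ∀ t, 1 ≤ t → θ (t+1) = M (θ t)) :
    (∀ t, 1 ≤ t → θ t ∈ Metric.closedBall θs r) ∧
    (∀ t, 1 ≤ t → ‖θ t - θs‖ ≤ (β/α)^(t-1) * ‖θ 1 - θs‖) ∧
    (∀ ε : ℝ, 0 < ε → ∀ T, 1 ≤ T → (β/α)^(T-1) * r ≤ ε → ‖θ T - θs‖ ≤ ε) := by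
  have hα : 0 < α := hβ.trans hβα
  have hs : θs ∈ Metric.closedBall θs r := Metric.mem_closedBall_self hr.le
  have hstep : ∀ x ∈ Metric.closedBall θs r, ‖M x - θs‖ ≤ β / α * ‖x - θs‖ := by
    intro x hx
    have hlow := mul_norm_sub_le_norm_sub_of_strong_concave
      (hLSC _ (hmap x hx) _ hs) (hLSC _ hs _ (hmap x hx))
    have hup := hLSS x hx θs hs
    rw [hself] at hup
    rw [div_mul_eq_mul_div, le_div_iff₀ hα, mul_comm]
    exact hlow.trans hup
  have hball : ∀ t, 1 ≤ t → θ t ∈ Metric.closedBall θs r := by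
    intro t ht
    induction t, ht using Nat.le_induction with
    | base => exact hθ1
    | succ t ht ih => exact hit t ht ▸ hmap _ ih
  have hrate : ∀ t, 1 ≤ t → ‖θ t - θs‖ ≤ (β / α) ^ (t - 1) * ‖θ 1 - θs‖ := by
    intro t ht
    induction t, ht using Nat.le_induction with
    | base => simp
    | succ t ht ih =>
      obtain ⟨k, rfl⟩ := Nat.exists_eq_add_of_le' ht
      rw [hit _ ht]
      calc ‖M (θ (k + 1)) - θs‖ ≤ β / α * ‖θ (k + 1) - θs‖ := hstep _ (hball _ ht)
        _ ≤ β / α * ((β / α) ^ (k + 1 - 1) * ‖θ 1 - θs‖) := by gcongr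
        _ = (β / α) ^ (k + 1 + 1 - 1) * ‖θ 1 - θs‖ := by
          simp only [Nat.add_sub_cancel, pow_succ]
          ring
  refine ⟨hball, hrate, fun ε _ T hT hε => (hrate T hT).trans (le_trans ?_ hε)⟩
  have hr1 : ‖θ 1 - θs‖ ≤ r := mem_closedBall_iff_norm.mp hθ1
  gcongr
end

section
/- Let f : ℝ^p → ℝ be differentiable and β-strongly smooth. Let ζ be a random vector on a probability space taking values in ℝ^p with ‖ζ‖₂ = 1 almost surely and E[ζ] = 0. Fix x ∈ ℝ^p and η > 0, and set x⁺ = x − η·(∇f(x) + ζ). Then the noisy gradient step decreases the objective on expectation as: E[f(x⁺)] ≤ f(x) − η·(1 − βη/2)·‖∇f(x)‖₂² + βη²/2. In particular, if η ≤ 1/β and ‖∇f(x)‖₂² ≥ 2ηβ, then E[f(x⁺)] ≤ f(x) − βη²/2. -/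
open scoped RealInnerProductSpace
open MeasureTheory

/-- A continuous function of a random vector supported almost surely on a sphere is integrable. -/
lemma integrable_comp_of_ae_norm_eq {E F Ω : Type*} [NormedAddCommGroup E] [ProperSpace E]
    [NormedAddCommGroup F] [MeasurableSpace Ω] {μ : Measure Ω} [IsFiniteMeasure μ]
    {h : E → F} (hh : Continuous h) {ζ : Ω → E} (hζ : AEStronglyMeasurable ζ μ)
    {r : ℝ} (hnorm : ∀ᵐ ω ∂μ, ‖ζ ω‖ = r) : Integrable (fun ω => h (ζ ω)) μ := by
  obtain ⟨C, hC⟩ := (isCompact_sphere (0 : E) r).exists_bound_of_continuousOn hh.continuousOn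
  refine Integrable.of_bound (hh.comp_aestronglyMeasurable hζ) C ?_
  filter_upwards [hnorm] with ω hω
  exact hC _ (by simpa using hω)

/-- The one-step descent inequality for a gradient step perturbed by a unit vector. -/
lemma noisy_step_le {E : Type*} [NormedAddCommGroup E] [InnerProductSpace ℝ E]
    {f : E → ℝ} {g : E → E} {β : ℝ}
    (hss : ∀ x y, f y - f x - ⟪g x, y - x⟫ ≤ (β / 2) * ‖y - x‖ ^ 2)
    (x : E) (η : ℝ) {z : E} (hz : ‖z‖ = 1) :
    f (x - η • (g x + z)) ≤
      (f x - η * (1 - β * η / 2) * ‖g x‖ ^ 2 + β * η ^ 2 / 2) + (β * η ^ 2 - η) * ⟪g x, z⟫ := by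
  have h := hss x (x - η • (g x + z))
  rw [sub_sub_cancel_left, norm_neg, norm_smul, mul_pow, Real.norm_eq_abs, sq_abs,
    norm_add_sq_real, hz, inner_neg_right, inner_smul_right, inner_add_right,
    real_inner_self_eq_norm_sq] at h
  linarith

/-- A noisy gradient step on a `β`-strongly smooth function, with isotropic unit-norm
zero-mean noise `ζ`, decreases the objective on expectation:
`E[f(x⁺)] ≤ f(x) - η(1 - βη/2)‖∇f(x)‖² + βη²/2`; in particular, if `η ≤ 1/β` and
`‖∇f(x)‖² ≥ 2ηβ`, then `E[f(x⁺)] ≤ f(x) - βη²/2`. -/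
theorem ngd_expected_descent
    {p : ℕ} {Ω : Type*} [MeasurableSpace Ω]
    (μ : Measure Ω) [IsProbabilityMeasure μ]
    (f : EuclideanSpace ℝ (Fin p) → ℝ)
    (g : EuclideanSpace ℝ (Fin p) → EuclideanSpace ℝ (Fin p))
    (hgrad : ∀ x, HasGradientAt f (g x) x)
    (β : ℝ) (hβ : 0 < β)
    (hss : ∀ x y, f y - f x - ⟪g x, y - x⟫ ≤ (β/2) * ‖y - x‖^2)
    (ζ : Ω → EuclideanSpace ℝ (Fin p))
    (hζint : Integrable ζ μ)
    (hζnorm : ∀ᵐ ω ∂μ, ‖ζ ω‖ = 1)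
    (hζmean : ∫ ω, ζ ω ∂μ = 0)
    (x : EuclideanSpace ℝ (Fin p)) (η : ℝ) (hη : 0 < η) :
    (∫ ω, f (x - η • (g x + ζ ω)) ∂μ
        ≤ f x - η * (1 - β * η / 2) * ‖g x‖^2 + β * η^2 / 2) ∧
    (η ≤ 1/β → 2 * η * β ≤ ‖g x‖^2 →
      ∫ ω, f (x - η • (g x + ζ ω)) ∂μ ≤ f x - β * η^2 / 2) := by
  have hf : Continuous f :=
    continuous_iff_continuousAt.2 fun y => (hgrad y).continuousAt
  have hint : Integrable (fun ω => f (x - η • (g x + ζ ω))) μ :=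
    integrable_comp_of_ae_norm_eq (h := fun z => f (x - η • (g x + z))) (by fun_prop)
      hζint.aestronglyMeasurable hζnorm
  have hinner : ∫ ω, ⟪g x, ζ ω⟫ ∂μ = 0 := by
    rw [integral_inner hζint, hζmean, inner_zero_right]
  have hlin : Integrable (fun ω => (β * η ^ 2 - η) * ⟪g x, ζ ω⟫) μ :=
    (hζint.const_inner (g x)).const_mul _
  have main : ∫ ω, f (x - η • (g x + ζ ω)) ∂μ
      ≤ f x - η * (1 - β * η / 2) * ‖g x‖ ^ 2 + β * η ^ 2 / 2 := by
    refine (integral_mono_ae hint ((integrable_const _).add hlin)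
      (hζnorm.mono fun ω hω => noisy_step_le hss x η hω)).trans_eq ?_
    simp only [Pi.add_apply]
    rw [integral_add (integrable_const _) hlin, integral_const_mul, hinner]
    simp
  refine ⟨main, fun hηβ hg => main.trans ?_⟩
  have hβη : β * η ≤ 1 := by
    rwa [le_div_iff₀ hβ, mul_comm] at hηβ
  have hstep : η * (1 / 2) * (2 * η * β) ≤ η * (1 - β * η / 2) * ‖g x‖ ^ 2 := by
    have hcoef : 1 / 2 ≤ 1 - β * η / 2 := by linarith
    exact mul_le_mul (mul_le_mul_of_nonneg_left hcoef hη.le) hg (by positivity)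
      (mul_nonneg hη.le (by linarith))
  linarith
end

section
/- Let f : ℝ^p → ℝ be differentiable, α-strongly convex, and have β-Lipschitz gradient, i.e., ‖∇f(x) − ∇f(y)‖₂ ≤ β‖x − y‖₂ for all x, y. Let x* satisfy ∇f(x*) = 0. Let ζ be a random vector with ‖ζ‖₂ = 1 almost surely and E[ζ] = 0. Fix x ∈ ℝ^p and 0 < η ≤ α/β², and set x⁺ = x − η·(∇f(x) + ζ). Then E[‖x⁺ − x*‖₂²] ≤ (1 − ηα)·‖x − x*‖₂² + η²; equivalently, E[‖x⁺ − x*‖₂² − η/α] ≤ (1 − ηα)·(‖x − x*‖₂² − η/α). -/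
open scoped RealInnerProductSpace
open MeasureTheory

section Helpers

variable {E : Type*} [NormedAddCommGroup E] [InnerProductSpace ℝ E]

/-- The gradient of an `α`-strongly convex function is `α`-strongly monotone. -/
theorem strongly_monotone_of_strongly_convex {f : E → ℝ} {g : E → E} {α : ℝ}
    (hsc : ∀ x y, (α / 2) * ‖y - x‖ ^ 2 ≤ f y - f x - ⟪g x, y - x⟫) (x y : E) :
    α * ‖x - y‖ ^ 2 ≤ ⟪g x - g y, x - y⟫ := by
  have hxy := hsc x y
  have hyx := hsc y x
  rw [norm_sub_rev y x, ← neg_sub x y, inner_neg_right] at hxy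
  rw [inner_sub_left]
  linarith

/-- A gradient step with small step size contracts the squared distance to a critical point. -/
theorem norm_sub_smul_sq_le {d v : E} {α β η : ℝ} (hβ : 0 < β)
    (hη0 : 0 < η) (hηβ : η ≤ α / β ^ 2)
    (hmono : α * ‖d‖ ^ 2 ≤ ⟪v, d⟫) (hlip : ‖v‖ ≤ β * ‖d‖) :
    ‖d - η • v‖ ^ 2 ≤ (1 - η * α) * ‖d‖ ^ 2 := by
  have hexp : ‖d - η • v‖ ^ 2 = ‖d‖ ^ 2 - 2 * (η * ⟪v, d⟫) + η ^ 2 * ‖v‖ ^ 2 := by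
    rw [norm_sub_sq_real, inner_smul_right, real_inner_comm, norm_smul, mul_pow,
      Real.norm_eq_abs, sq_abs]
  have hv : ‖v‖ ^ 2 ≤ β ^ 2 * ‖d‖ ^ 2 := by
    rw [← mul_pow]
    gcongr
  have hstep : η * β ^ 2 ≤ α := (le_div_iff₀ (by positivity)).mp hηβ
  have h₁ : η * (α * ‖d‖ ^ 2) ≤ η * ⟪v, d⟫ := by gcongr
  have h₂ : η ^ 2 * ‖v‖ ^ 2 ≤ η ^ 2 * (β ^ 2 * ‖d‖ ^ 2) := by gcongr
  have h₃ : η * ‖d‖ ^ 2 * (η * β ^ 2) ≤ η * ‖d‖ ^ 2 * α := by gcongr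
  rw [hexp]
  linarith

/-- Perturbing a vector by `η` times zero-mean unit-norm noise raises its expected squared norm
by exactly `η ^ 2`. -/
theorem integrable_and_integral_norm_sub_smul_sq [CompleteSpace E]
    {Ω : Type*} [MeasurableSpace Ω] {μ : Measure Ω} [IsProbabilityMeasure μ] {ζ : Ω → E}
    (hζint : Integrable ζ μ) (hζnorm : ∀ᵐ ω ∂μ, ‖ζ ω‖ = 1) (hζmean : ∫ ω, ζ ω ∂μ = 0)
    (w : E) (η : ℝ) :
    Integrable (fun ω => ‖w - η • ζ ω‖ ^ 2) μ ∧
      ∫ ω, ‖w - η • ζ ω‖ ^ 2 ∂μ = ‖w‖ ^ 2 + η ^ 2 := by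
  have hae : (fun ω => ‖w - η • ζ ω‖ ^ 2) =ᵐ[μ]
      fun ω => (‖w‖ ^ 2 + η ^ 2) - 2 * η * ⟪w, ζ ω⟫ := by
    filter_upwards [hζnorm] with ω hω
    rw [norm_sub_sq_real, inner_smul_right, norm_smul, hω, mul_one, Real.norm_eq_abs, sq_abs]
    ring
  have hint : Integrable (fun ω => 2 * η * ⟪w, ζ ω⟫) μ := (hζint.const_inner w).const_mul _
  refine ⟨((integrable_const _).sub hint).congr hae.symm, ?_⟩
  rw [integral_congr_ae hae, integral_sub (integrable_const _) hint, integral_const_mul,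
    integral_inner hζint, hζmean]
  simp

end Helpers

/-- A noisy gradient step on an `α`-strongly convex function with `β`-Lipschitz gradients,
near its unconstrained optimum `x*` (where `∇f(x*) = 0`), with unit-norm zero-mean noise
and step `0 < η ≤ α/β²`, contracts the expected squared distance:
`E[‖x⁺ - x*‖²] ≤ (1 - ηα)‖x - x*‖² + η²`, equivalently
`E[‖x⁺ - x*‖² - η/α] ≤ (1 - ηα)(‖x - x*‖² - η/α)`. -/
theorem ngd_entrapment_step
    {p : ℕ} {Ω : Type*} [MeasurableSpace Ω]
    (μ : Measure Ω) [IsProbabilityMeasure μ]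
    (f : EuclideanSpace ℝ (Fin p) → ℝ)
    (g : EuclideanSpace ℝ (Fin p) → EuclideanSpace ℝ (Fin p))
    (hgrad : ∀ x, HasGradientAt f (g x) x)
    (α β : ℝ) (hα : 0 < α) (hβ : 0 < β)
    (hsc : ∀ x y, (α/2) * ‖y - x‖^2 ≤ f y - f x - ⟪g x, y - x⟫)
    (hlip : ∀ x y, ‖g x - g y‖ ≤ β * ‖x - y‖)
    (xstar : EuclideanSpace ℝ (Fin p)) (hgstar : g xstar = 0)
    (ζ : Ω → EuclideanSpace ℝ (Fin p))
    (hζint : Integrable ζ μ)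
    (hζnorm : ∀ᵐ ω ∂μ, ‖ζ ω‖ = 1)
    (hζmean : ∫ ω, ζ ω ∂μ = 0)
    (x : EuclideanSpace ℝ (Fin p)) (η : ℝ) (hη0 : 0 < η) (hηβ : η ≤ α / β^2) :
    (∫ ω, ‖x - η • (g x + ζ ω) - xstar‖^2 ∂μ
        ≤ (1 - η * α) * ‖x - xstar‖^2 + η^2) ∧
    (∫ ω, (‖x - η • (g x + ζ ω) - xstar‖^2 - η/α) ∂μ
        ≤ (1 - η * α) * (‖x - xstar‖^2 - η/α)) := by
  obtain ⟨hint, hval⟩ := integrable_and_integral_norm_sub_smul_sq hζint hζnorm hζmean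
    (x - xstar - η • g x) η
  have hsplit : ∀ ω, x - η • (g x + ζ ω) - xstar = x - xstar - η • g x - η • ζ ω := fun ω => by
    rw [smul_add]
    abel
  have hmono := strongly_monotone_of_strongly_convex hsc x xstar
  have hnorm := hlip x xstar
  rw [hgstar, sub_zero] at hmono hnorm
  have hcontract := norm_sub_smul_sq_le hβ hη0 hηβ hmono hnorm
  simp only [hsplit]
  refine ⟨by linarith, ?_⟩
  rw [integral_sub hint (integrable_const _), hval]
  have hoffset : (1 - η * α) * (η / α) = η / α - η ^ 2 := by
    field_simp
  simp only [integral_const, probReal_univ, one_smul]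
  rw [mul_sub, hoffset]
  linarith
end

section
/- Let X ∈ ℝ^{n×p} satisfy the restricted isometry property of order 3s with constant δ ∈ [0,1). Let θ* ∈ ℝ^p with ‖θ*‖₀ ≤ s and y = Xθ*. Suppose θ^t ∈ ℝ^p with ‖θ^t‖₀ ≤ s, let z^{t+1} = θ^t − (1/n)·Xᵀ(Xθ^t − y), and let θ^{t+1} be any s-sparse vector closest to z^{t+1} in Euclidean norm, i.e., ‖θ^{t+1}‖₀ ≤ s and ‖θ^{t+1} − z^{t+1}‖₂ ≤ ‖w − z^{t+1}‖₂ for every w with ‖w‖₀ ≤ s. Then ‖θ^{t+1} − θ*‖₂ ≤ 2δ·‖θ^t − θ*‖₂. In particular, if δ < 1/2, the iterative hard thresholding iterates started at θ¹ = 0 satisfy ‖θ^t − θ*‖₂ ≤ (2δ)^{t−1}·‖θ*‖₂, so ‖θ^t − θ*‖₂ ≤ ε after t = O(log(‖θ*‖₂/ε)) iterations. -/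
/-- The Euclidean norm of a vector in `ℝ^n`. -/
noncomputable def euclideanNorm {n : ℕ} (v : Fin n → ℝ) : ℝ :=
  Real.sqrt (∑ i, v i ^ 2)

/-- A vector in `ℝ^n` is `s`-sparse if its nonzero coordinates are contained in a set of
at most `s` coordinates. -/
def IsSparse {n : ℕ} (s : ℕ) (v : Fin n → ℝ) : Prop :=
  ∃ T : Finset (Fin n), T.card ≤ s ∧ ∀ i, i ∉ T → v i = 0

theorem euclideanNorm_le_mul {m : ℕ} {u v : Fin m → ℝ} {c : ℝ} (hc : 0 ≤ c)
    (h : ∑ i, u i ^ 2 ≤ c ^ 2 * ∑ i, v i ^ 2) : euclideanNorm u ≤ c * euclideanNorm v := by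
  unfold euclideanNorm
  calc √(∑ i, u i ^ 2) ≤ √(c ^ 2 * ∑ i, v i ^ 2) := Real.sqrt_le_sqrt h
    _ = c * √(∑ i, v i ^ 2) := by rw [Real.sqrt_mul (sq_nonneg c), Real.sqrt_sq hc]

/-- A vector at least as close to `z` as `b` satisfies the basic inequality
`‖a - b‖² ≤ 2⟪a - b, z - b⟫`. -/
theorem sum_sq_sub_le_of_euclideanNorm_le {m : ℕ} {a b z : Fin m → ℝ}
    (h : euclideanNorm (a - z) ≤ euclideanNorm (b - z)) :
    ∑ i, (a - b) i ^ 2 ≤ 2 * ((a - b) ⬝ᵥ (z - b)) := by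
  have h' : ∑ i, (a - z) i ^ 2 ≤ ∑ i, (b - z) i ^ 2 :=
    (Real.sqrt_le_sqrt_iff (Finset.sum_nonneg fun i _ => sq_nonneg _)).1 h
  have e : ∑ i, (a - z) i ^ 2 - ∑ i, (b - z) i ^ 2
      = ∑ i, (a - b) i ^ 2 - 2 * ((a - b) ⬝ᵥ (z - b)) := by
    simp only [dotProduct, Pi.sub_apply, Finset.mul_sum, ← Finset.sum_sub_distrib]
    exact Finset.sum_congr rfl fun i _ => by ring
  linarith

/-- Polarization of the restricted isometry property: if it holds at `u + v` and `u - v`, then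
`⟪u, (1 - XᵀX/n) v⟫` is at most `δ/2 * (‖u‖² + ‖v‖²)`. -/
theorem two_mul_dotProduct_sub_le_of_rip {n p : ℕ} {X : Matrix (Fin n) (Fin p) ℝ} {δ : ℝ}
    {u v : Fin p → ℝ}
    (hadd : (1 - δ) * (∑ i, (u + v) i ^ 2) ≤ (1 / (n : ℝ)) * (∑ i, (X.mulVec (u + v)) i ^ 2))
    (hsub : (1 / (n : ℝ)) * (∑ i, (X.mulVec (u - v)) i ^ 2) ≤ (1 + δ) * (∑ i, (u - v) i ^ 2)) :
    2 * (u ⬝ᵥ (v - (1 / (n : ℝ)) • X.transpose.mulVec (X.mulVec v)))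
      ≤ δ * (∑ i, u i ^ 2 + ∑ i, v i ^ 2) := by
  have sq {k : ℕ} (w : Fin k → ℝ) : ∑ i, w i ^ 2 = w ⬝ᵥ w :=
    Finset.sum_congr rfl fun i _ => pow_two _
  have adj : u ⬝ᵥ X.transpose.mulVec (X.mulVec v) = X.mulVec u ⬝ᵥ X.mulVec v := by
    rw [Matrix.dotProduct_mulVec, Matrix.vecMul_transpose]
  simp only [sq, Matrix.mulVec_add, Matrix.mulVec_sub, add_dotProduct, dotProduct_add,
    sub_dotProduct, dotProduct_sub, dotProduct_smul, smul_eq_mul, adj] at hadd hsub ⊢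
  rw [dotProduct_comm v u, dotProduct_comm (X.mulVec v)] at hadd hsub
  linarith

/-- One step of iterative hard thresholding contracts the distance to the model by `2δ`. -/
theorem iht_step_contraction {n p s : ℕ} {X : Matrix (Fin n) (Fin p) ℝ} {δ : ℝ} (hδ0 : 0 ≤ δ)
    (hRIP : ∀ θ : Fin p → ℝ, IsSparse (3*s) θ →
      (1 - δ) * (∑ i, θ i ^ 2) ≤ (1/(n:ℝ)) * (∑ i, (X.mulVec θ) i ^ 2) ∧
      (1/(n:ℝ)) * (∑ i, (X.mulVec θ) i ^ 2) ≤ (1 + δ) * (∑ i, θ i ^ 2))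
    {a b c : Fin p → ℝ} (ha : IsSparse s a) (hb : IsSparse s b) (hc : IsSparse s c)
    (h : euclideanNorm (b - (a - (1/(n:ℝ)) • (X.transpose.mulVec (X.mulVec a - X.mulVec c))))
      ≤ euclideanNorm (c - (a - (1/(n:ℝ)) • (X.transpose.mulVec (X.mulVec a - X.mulVec c))))) :
    euclideanNorm (b - c) ≤ 2 * δ * euclideanNorm (a - c) := by
  obtain ⟨A, hA, ha⟩ := ha
  obtain ⟨B, hB, hb⟩ := hb
  obtain ⟨C, hC, hc⟩ := hc
  have sparse (r q : ℝ) : IsSparse (3 * s) (r • (b - c) + q • (a - c)) := by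
    refine ⟨A ∪ B ∪ C, ?_, fun i hi => ?_⟩
    · have h1 := Finset.card_union_le (A ∪ B) C
      have h2 := Finset.card_union_le A B
      omega
    · simp only [Finset.mem_union, not_or] at hi
      simp [ha i hi.1.1, hb i hi.1.2, hc i hi.2]
  have basic := sum_sq_sub_le_of_euclideanNorm_le h
  rw [← Matrix.mulVec_sub, sub_right_comm] at basic
  have key (r : ℝ) :
      2 * (r * ((b - c) ⬝ᵥ ((a - c) - (1 / (n : ℝ)) • X.transpose.mulVec (X.mulVec (a - c)))))
        ≤ δ * (∑ i, (b - c) i ^ 2 + r ^ 2 * ∑ i, (a - c) i ^ 2) := by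
    have hadd := (hRIP _ (sparse 1 r)).1
    have hsub := (hRIP _ (sparse 1 (-r))).2
    rw [one_smul] at hadd hsub
    rw [neg_smul, ← sub_eq_add_neg] at hsub
    have := two_mul_dotProduct_sub_le_of_rip hadd hsub
    rwa [Matrix.mulVec_smul, Matrix.mulVec_smul, smul_comm, ← smul_sub, dotProduct_smul,
      smul_eq_mul, show ∑ i, (r • (a - c)) i ^ 2 = r ^ 2 * ∑ i, (a - c) i ^ 2 by
        simp only [Pi.smul_apply, smul_eq_mul, mul_pow, Finset.mul_sum]] at this
  refine euclideanNorm_le_mul (by positivity) ?_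
  rcases hδ0.eq_or_lt with rfl | hδ
  · linarith [key 1]
  · have := key (2 * δ)
    refine le_of_mul_le_mul_left ?_ hδ
    nlinarith [mul_le_mul_of_nonneg_left basic hδ.le]

/-- Iterative hard thresholding under the restricted isometry property of order `3s` with
constant `δ`: each IHT step contracts the distance to the `s`-sparse model `θ*` by `2δ`,
and if `δ < 1/2`, the IHT iterates started at `θ¹ = 0` satisfy
`‖θᵗ - θ*‖₂ ≤ (2δ)^{t-1}‖θ*‖₂`. -/
theorem iht_sparse_recovery
    {n p s : ℕ}
    (X : Matrix (Fin n) (Fin p) ℝ)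
    (δ : ℝ) (hδ0 : 0 ≤ δ) (hδ1 : δ < 1)
    (hRIP : ∀ θ : Fin p → ℝ, IsSparse (3*s) θ →
      (1 - δ) * (∑ i, θ i ^ 2) ≤ (1/(n:ℝ)) * (∑ i, (X.mulVec θ) i ^ 2) ∧
      (1/(n:ℝ)) * (∑ i, (X.mulVec θ) i ^ 2) ≤ (1 + δ) * (∑ i, θ i ^ 2))
    (θstar : Fin p → ℝ) (hθstar : IsSparse s θstar)
    (y : Fin n → ℝ) (hy : y = X.mulVec θstar) :
    (∀ θt θt1 : Fin p → ℝ, IsSparse s θt → IsSparse s θt1 →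
      (∀ w : Fin p → ℝ, IsSparse s w →
        euclideanNorm (θt1 - (θt - (1/(n:ℝ)) • (X.transpose.mulVec (X.mulVec θt - y))))
          ≤ euclideanNorm (w - (θt - (1/(n:ℝ)) • (X.transpose.mulVec (X.mulVec θt - y))))) →
      euclideanNorm (θt1 - θstar) ≤ 2 * δ * euclideanNorm (θt - θstar)) ∧
    (δ < 1/2 →
      ∀ θseq : ℕ → Fin p → ℝ, θseq 1 = 0 →
      (∀ t, 1 ≤ t → IsSparse s (θseq (t+1)) ∧
        ∀ w : Fin p → ℝ, IsSparse s w →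
          euclideanNorm (θseq (t+1) -
              (θseq t - (1/(n:ℝ)) • (X.transpose.mulVec (X.mulVec (θseq t) - y))))
            ≤ euclideanNorm (w -
              (θseq t - (1/(n:ℝ)) • (X.transpose.mulVec (X.mulVec (θseq t) - y))))) →
      ∀ t, 1 ≤ t →
        euclideanNorm (θseq t - θstar) ≤ (2*δ)^(t-1) * euclideanNorm θstar) := by
  subst hy
  have step : ∀ θt θt1 : Fin p → ℝ, IsSparse s θt → IsSparse s θt1 →
      (∀ w : Fin p → ℝ, IsSparse s w →
        euclideanNorm (θt1 - (θt - (1/(n:ℝ)) •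
            (X.transpose.mulVec (X.mulVec θt - X.mulVec θstar))))
          ≤ euclideanNorm (w - (θt - (1/(n:ℝ)) •
            (X.transpose.mulVec (X.mulVec θt - X.mulVec θstar))))) →
      euclideanNorm (θt1 - θstar) ≤ 2 * δ * euclideanNorm (θt - θstar) :=
    fun _ _ ht ht1 hmin => iht_step_contraction hδ0 hRIP ht ht1 hθstar (hmin θstar hθstar)
  refine ⟨step, fun _ θseq h1 hseq t ht => ?_⟩
  have sparse : ∀ t, 1 ≤ t → IsSparse s (θseq t) := by
    intro t ht
    induction t, ht using Nat.le_induction with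
    | base => exact ⟨∅, by simp, by simp [h1]⟩
    | succ t ht _ => exact (hseq t ht).1
  induction t, ht using Nat.le_induction with
  | base => simp [h1, euclideanNorm]
  | succ t ht ih =>
    obtain ⟨k, rfl⟩ := Nat.exists_eq_add_of_le' ht
    refine (step _ _ (sparse _ ht) (hseq _ ht).1 (hseq _ ht).2).trans ?_
    simp only [Nat.add_sub_cancel] at ih ⊢
    rw [pow_succ', mul_assoc (2 * δ)]
    exact mul_le_mul_of_nonneg_left ih (by positivity)
end

section
/- Let A : ℝ^{m×n} → ℝ^k be a linear map satisfying the matrix restricted isometry property of order 2r with constant δ ∈ [0,1), and let A* : ℝ^k → ℝ^{m×n} be its adjoint with respect to the Frobenius inner product. Let X* ∈ ℝ^{m×n} have rank at most r and y = A(X*). Suppose X^t has rank at most r, let Y^{t+1} = X^t − (1/(1+δ))·A*(A(X^t) − y), and let X^{t+1} be a best rank-r approximation of Y^{t+1} in Frobenius norm, i.e., rank(X^{t+1}) ≤ r and ‖X^{t+1} − Y^{t+1}‖_F ≤ ‖Z − Y^{t+1}‖_F for every Z with rank(Z) ≤ r. Then ‖A(X^{t+1}) − y‖₂² ≤ (2δ/(1−δ))·‖A(X^t)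 − y‖₂². In particular, if δ < 1/3, the singular value projection iterates started at X¹ = 0 satisfy ‖A(X^t) − y‖₂² ≤ (2δ/(1−δ))^{t−1}·‖y‖₂². -/
/-- The Frobenius norm of a real matrix. -/
noncomputable def frobNorm {m n : ℕ} (X : Matrix (Fin m) (Fin n) ℝ) : ℝ :=
  Real.sqrt (∑ i, ∑ j, X i j ^ 2)

theorem sum_add_mul_sq {ι : Type*} [Fintype ι] (c : ℝ) (u v : ι → ℝ) :
    ∑ i, (u i + c * v i) ^ 2 =
      ∑ i, u i ^ 2 + 2 * c * ∑ i, u i * v i + c ^ 2 * ∑ i, v i ^ 2 := by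
  simp only [Finset.mul_sum, ← Finset.sum_add_distrib]
  exact Finset.sum_congr rfl fun i _ => by ring

theorem Matrix.sum_sq_add_smul {m n : ℕ} (c : ℝ) (P G : Matrix (Fin m) (Fin n) ℝ) :
    ∑ i, ∑ j, (P + c • G) i j ^ 2 =
      ∑ i, ∑ j, P i j ^ 2 + 2 * c * ∑ i, ∑ j, P i j * G i j
        + c ^ 2 * ∑ i, ∑ j, G i j ^ 2 := by
  simp only [Matrix.add_apply, Matrix.smul_apply, smul_eq_mul, sum_add_mul_sq,
    Finset.sum_add_distrib, Finset.mul_sum]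

theorem Matrix.rank_sub_le_add {m n : ℕ} (P Q : Matrix (Fin m) (Fin n) ℝ) :
    (P - Q).rank ≤ P.rank + Q.rank := by
  have hsub : LinearMap.range (P - Q).mulVecLin ≤
      LinearMap.range P.mulVecLin ⊔ LinearMap.range Q.mulVecLin := by
    rintro _ ⟨x, rfl⟩
    rw [Matrix.mulVecLin_apply, Matrix.sub_mulVec]
    exact Submodule.sub_mem_sup ⟨x, rfl⟩ ⟨x, rfl⟩
  exact (Submodule.finrank_mono hsub).trans (Submodule.finrank_add_le_finrank_add_finrank _ _)

theorem sum_sq_le_of_frobNorm_le {m n : ℕ} {P Q : Matrix (Fin m) (Fin n) ℝ}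
    (h : frobNorm P ≤ frobNorm Q) : ∑ i, ∑ j, P i j ^ 2 ≤ ∑ i, ∑ j, Q i j ^ 2 :=
  (Real.sqrt_le_sqrt_iff (by positivity)).mp h

/-- One step of singular value projection contracts the squared residual. -/
theorem svp_step_residual_le
    {m n k r : ℕ}
    (A : Matrix (Fin m) (Fin n) ℝ →ₗ[ℝ] (Fin k → ℝ))
    (Astar : (Fin k → ℝ) →ₗ[ℝ] Matrix (Fin m) (Fin n) ℝ)
    (hadj : ∀ (X : Matrix (Fin m) (Fin n) ℝ) (v : Fin k → ℝ),
      ∑ i, A X i * v i = ∑ i, ∑ j, X i j * Astar v i j)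
    (δ : ℝ) (hδ0 : 0 ≤ δ) (hδ1 : δ < 1)
    (hRIP : ∀ X : Matrix (Fin m) (Fin n) ℝ, X.rank ≤ 2*r →
      (1 - δ) * (∑ i, ∑ j, X i j ^ 2) ≤ (∑ i, (A X i)^2) ∧
      (∑ i, (A X i)^2) ≤ (1 + δ) * (∑ i, ∑ j, X i j ^ 2))
    (Xstar : Matrix (Fin m) (Fin n) ℝ) (hXstar : Xstar.rank ≤ r)
    (y : Fin k → ℝ) (hy : y = A Xstar)
    (Xt Xt1 : Matrix (Fin m) (Fin n) ℝ) (hXt : Xt.rank ≤ r) (hXt1 : Xt1.rank ≤ r)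
    (hbest : frobNorm (Xt1 - (Xt - (1/(1+δ)) • Astar (A Xt - y)))
      ≤ frobNorm (Xstar - (Xt - (1/(1+δ)) • Astar (A Xt - y)))) :
    (∑ i, (A Xt1 i - y i)^2) ≤ (2*δ/(1-δ)) * (∑ i, (A Xt i - y i)^2) := by
  have hle := sum_sq_le_of_frobNorm_le hbest
  rw [← sub_add, ← sub_add, Matrix.sum_sq_add_smul, Matrix.sum_sq_add_smul,
    ← hadj, ← hadj] at hle
  have hD := (hRIP (Xt1 - Xt) (by have := Matrix.rank_sub_le_add Xt1 Xt; omega)).2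
  have hE := (hRIP (Xstar - Xt) (by have := Matrix.rank_sub_le_add Xstar Xt; omega)).1
  have hgg : ∑ i, A (Xstar - Xt) i * (A Xt - y) i = -∑ i, (A Xt i - y i) ^ 2 := by
    rw [← Finset.sum_neg_distrib]
    refine Finset.sum_congr rfl fun i _ => ?_
    simp only [hy, map_sub, Pi.sub_apply]
    ring
  have hEg : ∑ i, A (Xstar - Xt) i ^ 2 = ∑ i, (A Xt i - y i) ^ 2 := by
    refine Finset.sum_congr rfl fun i _ => ?_
    simp only [hy, map_sub, Pi.sub_apply]
    ring
  have hres : ∑ i, (A Xt1 i - y i) ^ 2 = ∑ i, A (Xt1 - Xt) i ^ 2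
      + 2 * ∑ i, A (Xt1 - Xt) i * (A Xt - y) i + ∑ i, (A Xt i - y i) ^ 2 := by
    have h := sum_add_mul_sq 1 (A (Xt1 - Xt)) (A Xt - y)
    simp only [one_mul, mul_one, one_pow] at h
    simp only [Pi.sub_apply] at h ⊢
    rw [← h]
    refine Finset.sum_congr rfl fun i _ => ?_
    simp only [map_sub, Pi.sub_apply]
    ring
  rw [hgg] at hle
  rw [hEg] at hE
  rw [hres]
  generalize ∑ i, (A Xt i - y i) ^ 2 = g at *
  generalize ∑ i, A (Xt1 - Xt) i * (A Xt - y) i = p at *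
  generalize ∑ i, A (Xt1 - Xt) i ^ 2 = a at *
  generalize ∑ i, ∑ j, (Xt1 - Xt) i j ^ 2 = d at *
  generalize ∑ i, ∑ j, (Xstar - Xt) i j ^ 2 = e at *
  have hpos : 0 < 1 + δ := by linarith
  have hpos' : 0 < 1 - δ := by linarith
  have hle' : (1 + δ) * d + 2 * p ≤ (1 + δ) * e - 2 * g := by
    have h : d + 2 * (1 / (1 + δ)) * p ≤ e + 2 * (1 / (1 + δ)) * -g := by linarith
    have h := mul_le_mul_of_nonneg_left h hpos.le
    field_simp at h
    linarith
  have hfin : (1 + δ) * e - g ≤ 2 * δ / (1 - δ) * g := by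
    have he : e ≤ g / (1 - δ) := by rw [le_div_iff₀ hpos']; linarith
    calc (1 + δ) * e - g ≤ (1 + δ) * (g / (1 - δ)) - g := by gcongr
      _ = 2 * δ / (1 - δ) * g := by field_simp; ring
  linarith

/-- Singular value projection under the matrix restricted isometry property of order `2r`
with constant `δ`: each SVP step (gradient step with step length `1/(1+δ)` followed by a
best rank-`r` approximation in Frobenius norm) contracts the squared residual
`‖A(X) - y‖₂²` by a factor `2δ/(1-δ)`; if `δ < 1/3`, the SVP iterates started at `X¹ = 0`
satisfy `‖A(Xᵗ) - y‖₂² ≤ (2δ/(1-δ))^{t-1}‖y‖₂²`. -/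
theorem svp_matrix_recovery
    {m n k r : ℕ}
    (A : Matrix (Fin m) (Fin n) ℝ →ₗ[ℝ] (Fin k → ℝ))
    (Astar : (Fin k → ℝ) →ₗ[ℝ] Matrix (Fin m) (Fin n) ℝ)
    (hadj : ∀ (X : Matrix (Fin m) (Fin n) ℝ) (v : Fin k → ℝ),
      ∑ i, A X i * v i = ∑ i, ∑ j, X i j * Astar v i j)
    (δ : ℝ) (hδ0 : 0 ≤ δ) (hδ1 : δ < 1)
    (hRIP : ∀ X : Matrix (Fin m) (Fin n) ℝ, X.rank ≤ 2*r →
      (1 - δ) * (∑ i, ∑ j, X i j ^ 2) ≤ (∑ i, (A X i)^2) ∧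
      (∑ i, (A X i)^2) ≤ (1 + δ) * (∑ i, ∑ j, X i j ^ 2))
    (Xstar : Matrix (Fin m) (Fin n) ℝ) (hXstar : Xstar.rank ≤ r)
    (y : Fin k → ℝ) (hy : y = A Xstar) :
    (∀ Xt Xt1 : Matrix (Fin m) (Fin n) ℝ, Xt.rank ≤ r → Xt1.rank ≤ r →
      (∀ Z : Matrix (Fin m) (Fin n) ℝ, Z.rank ≤ r →
        frobNorm (Xt1 - (Xt - (1/(1+δ)) • Astar (A Xt - y)))
          ≤ frobNorm (Z - (Xt - (1/(1+δ)) • Astar (A Xt - y)))) →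
      (∑ i, (A Xt1 i - y i)^2) ≤ (2*δ/(1-δ)) * (∑ i, (A Xt i - y i)^2)) ∧
    (δ < 1/3 →
      ∀ Xseq : ℕ → Matrix (Fin m) (Fin n) ℝ, Xseq 1 = 0 →
      (∀ t, 1 ≤ t → (Xseq (t+1)).rank ≤ r ∧
        ∀ Z : Matrix (Fin m) (Fin n) ℝ, Z.rank ≤ r →
          frobNorm (Xseq (t+1) - (Xseq t - (1/(1+δ)) • Astar (A (Xseq t) - y)))
            ≤ frobNorm (Z - (Xseq t - (1/(1+δ)) • Astar (A (Xseq t) - y)))) →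
      ∀ t, 1 ≤ t →
        (∑ i, (A (Xseq t) i - y i)^2) ≤ (2*δ/(1-δ))^(t-1) * (∑ i, (y i)^2)) := by
  have step := svp_step_residual_le A Astar hadj δ hδ0 hδ1 hRIP Xstar hXstar y hy
  refine ⟨fun Xt Xt1 hXt hXt1 hbest => step Xt Xt1 hXt hXt1 (hbest Xstar hXstar), ?_⟩
  intro _ Xseq h1 hstep t ht
  have hrank : ∀ t, 1 ≤ t → (Xseq t).rank ≤ r := by
    intro t ht
    obtain rfl | ht := ht.eq_or_lt
    · simp [h1]
    · obtain ⟨s, rfl⟩ := Nat.exists_eq_add_of_lt ht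
      exact (hstep (1 + s) (by omega)).1
  induction t, ht using Nat.le_induction with
  | base => simp [h1]
  | succ t ht ih =>
    have hc : 0 ≤ 2 * δ / (1 - δ) := div_nonneg (by linarith) (by linarith)
    calc _ ≤ 2 * δ / (1 - δ) * ∑ i, (A (Xseq t) i - y i) ^ 2 :=
          step _ _ (hrank t ht) (hstep t ht).1 ((hstep t ht).2 Xstar hXstar)
      _ ≤ 2 * δ / (1 - δ) * ((2 * δ / (1 - δ)) ^ (t - 1) * ∑ i, y i ^ 2) :=
          mul_le_mul_of_nonneg_left ih hc
      _ = (2 * δ / (1 - δ)) ^ (t + 1 - 1) * ∑ i, y i ^ 2 := by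
          rw [← mul_assoc, ← pow_succ', show t - 1 + 1 = t + 1 - 1 by omega]
end

section
/- Let v ∈ ℝ^p with ‖v‖₂ = 1, let D = 4·vvᵀ + 4·I_p, and let S ∈ ℝ^{p×p} be a symmetric matrix with ‖S − D‖₂ ≤ c in operator norm, where 0 ≤ c ≤ 2. Let u be a unit-norm leading eigenvector of S, i.e., ‖u‖₂ = 1 and |⟨u, Su⟩| ≥ |⟨w, Sw⟩| for every unit vector w ∈ ℝ^p. Then ⟨u, v⟩² ≥ 1 − c/2, and consequently min(‖u − v‖₂², ‖u + v‖₂²) ≤ c. -/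
/-- An operator-norm bound on `M` bounds its quadratic form on unit vectors. -/
theorem abs_quadForm_le_of_sqrt_sum_sq_mulVec_le {n : Type*} [Fintype n] (M : Matrix n n ℝ) (c : ℝ)
    (hM : ∀ w : n → ℝ,
      Real.sqrt (∑ i, (M.mulVec w) i ^ 2) ≤ c * Real.sqrt (∑ i, w i ^ 2))
    (w : n → ℝ) (hw : ∑ i, w i ^ 2 = 1) :
    |∑ i, w i * (M.mulVec w) i| ≤ c := by
  have hcs := Finset.sum_mul_sq_le_sq_mul_sq Finset.univ w (M.mulVec w)
  have hb := hM w
  rw [hw, one_mul] at hcs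
  rw [hw, Real.sqrt_one, mul_one] at hb
  exact (Real.abs_le_sqrt hcs).trans hb

/-- The quadratic form of `S` splits off the spiked matrix `4vvᵀ + 4I`. -/
theorem quadForm_sub_spiked {n : Type*} [Fintype n] [DecidableEq n] (S : Matrix n n ℝ)
    (v w : n → ℝ) (hw : ∑ i, w i ^ 2 = 1) :
    ∑ i, w i * ((S - ((4:ℝ) • Matrix.vecMulVec v v +
      (4:ℝ) • (1 : Matrix n n ℝ))).mulVec w) i =
    ∑ i, w i * (S.mulVec w) i - (4 * (∑ i, w i * v i) ^ 2 + 4) := by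
  have hww : w ⬝ᵥ w = 1 := by simpa [dotProduct, sq] using hw
  change w ⬝ᵥ _ = w ⬝ᵥ _ - (4 * (w ⬝ᵥ v) ^ 2 + 4)
  simp only [Matrix.sub_mulVec, Matrix.add_mulVec, Matrix.smul_mulVec, Matrix.one_mulVec,
    Matrix.vecMulVec_mulVec, dotProduct_sub, dotProduct_add, dotProduct_smul, hww,
    dotProduct_comm v w, smul_eq_mul, MulOpposite.smul_eq_mul_unop, MulOpposite.unop_op]
  ring


/-- Deterministic core of the spectral-initialization guarantee for phase retrieval:
if `v` is a unit vector, `D = 4vvᵀ + 4I`, and `S` is a symmetric matrix with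
`‖S - D‖₂ ≤ c` in operator norm for some `0 ≤ c ≤ 2`, then any unit-norm leading
eigenvector `u` of `S` satisfies `⟨u, v⟩² ≥ 1 - c/2`, and consequently
`min(‖u - v‖₂², ‖u + v‖₂²) ≤ c`. -/
theorem phase_retrieval_spectral_initialization
    {p : ℕ} (v : Fin p → ℝ) (hv : ∑ i, v i ^ 2 = 1)
    (c : ℝ) (hc0 : 0 ≤ c) (hc2 : c ≤ 2)
    (S : Matrix (Fin p) (Fin p) ℝ) (hsym : S.IsSymm)
    (hSD : ∀ w : Fin p → ℝ,
      Real.sqrt (∑ i,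
        ((S - ((4:ℝ) • Matrix.vecMulVec v v + (4:ℝ) • (1 : Matrix (Fin p) (Fin p) ℝ))).mulVec w) i ^ 2)
        ≤ c * Real.sqrt (∑ i, w i ^ 2))
    (u : Fin p → ℝ) (hu : ∑ i, u i ^ 2 = 1)
    (hlead : ∀ w : Fin p → ℝ, ∑ i, w i ^ 2 = 1 →
      |∑ i, w i * (S.mulVec w) i| ≤ |∑ i, u i * (S.mulVec u) i|) :
    1 - c/2 ≤ (∑ i, u i * v i)^2 ∧
    min (∑ i, (u i - v i)^2) (∑ i, (u i + v i)^2) ≤ c := by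
  have hbound := abs_quadForm_le_of_sqrt_sum_sq_mulVec_le _ c hSD
  have hu' := hbound u hu
  have hv' := hbound v hv
  rw [quadForm_sub_spiked S v u hu, abs_le] at hu'
  have hvv : ∑ i, v i * v i = 1 := by simpa [sq] using hv
  rw [quadForm_sub_spiked S v v hv, hvv, abs_le] at hv'
  have hmax := hlead v hv
  have hpos : 0 ≤ ∑ i, u i * (S.mulVec u) i := by
    linarith [sq_nonneg (∑ i, u i * v i)]
  rw [abs_of_nonneg hpos] at hmax
  have hlow : 1 - c / 2 ≤ (∑ i, u i * v i) ^ 2 := by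
    linarith [le_abs_self (∑ i, v i * (S.mulVec v) i)]
  refine ⟨hlow, ?_⟩
  have hcs := Finset.sum_mul_sq_le_sq_mul_sq Finset.univ u v
  rw [hu, hv, one_mul] at hcs
  have hsub : ∑ i, (u i - v i) ^ 2 = 2 - 2 * ∑ i, u i * v i := by
    simp only [sub_sq, Finset.sum_add_distrib, Finset.sum_sub_distrib, hu, hv, mul_assoc,
      ← Finset.mul_sum]
    ring
  have hadd : ∑ i, (u i + v i) ^ 2 = 2 + 2 * ∑ i, u i * v i := by
    simp only [add_sq, Finset.sum_add_distrib, hu, hv, mul_assoc, ← Finset.mul_sum]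
    ring
  rw [hsub, hadd, min_le_iff]
  rcases le_total 0 (∑ i, u i * v i) with h | h
  · left
    nlinarith
  · right
    nlinarith
end
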